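/- Let A = 𝕜[x], B = 𝕜[y], and let c ∈ 𝕜 be such that S_n(c) ≠ 0 for every n ≥ 1. Then the linear map τ: B⊗A → A⊗B defined by the unital conditions together with τ(y^i⊗x^j) = S_{i+j}(c)^{-1}·(S_j(c)·x^{i+j}⊗1 + c^j·S_i(c)·1⊗y^{i+j}) for all i, j ≥ 1 is a graded twisting map; moreover τ has the unique extension property. -/

import Mathlib

open TensorProduct

noncomputable section

namespace TTP

variable (𝕜 : Type) [Field 𝕜]

/-- The image of `p ⊗ q` inside `M ⊗[𝕜] N`, for submodules `p ⊆ M`, `q ⊆ N`. -/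
def subTmul {M N : Type} [AddCommGroup M] [Module 𝕜 M] [AddCommGroup N] [Module 𝕜 N]
    (p : Submodule 𝕜 M) (q : Submodule 𝕜 N) : Submodule 𝕜 (M ⊗[𝕜] N) :=
  LinearMap.range (TensorProduct.map p.subtype q.subtype)

/-- The Künneth grading on a tensor product of graded vector spaces. -/
def kunneth {M N : Type} [AddCommGroup M] [Module 𝕜 M] [AddCommGroup N] [Module 𝕜 N]
    (𝒜 : ℕ → Submodule 𝕜 M) (ℬ : ℕ → Submodule 𝕜 N) (n : ℕ) : Submodule 𝕜 (M ⊗[𝕜] N) :=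
  ⨆ (pq : ℕ × ℕ) (_ : pq.1 + pq.2 = n), subTmul 𝕜 (𝒜 pq.1) (ℬ pq.2)

/-- The positive part `X₊ = ⊕_{i>0} X_i` of a graded vector space. -/
def plusPart {M : Type} [AddCommGroup M] [Module 𝕜 M] (𝒜 : ℕ → Submodule 𝕜 M) :
    Submodule 𝕜 M :=
  ⨆ (i : ℕ) (_ : 0 < i), 𝒜 i

/-- The grading concentrating `𝒜 1` in degree `1` (and `⊥` elsewhere). -/
def degOne {M : Type} [AddCommGroup M] [Module 𝕜 M] (𝒜 : ℕ → Submodule 𝕜 M) :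
    ℕ → Submodule 𝕜 M :=
  fun n => if n = 1 then 𝒜 1 else ⊥

variable (A B : Type) [Ring A] [Algebra 𝕜 A] [Ring B] [Algebra 𝕜 B]

/-- `τ ∘ (μ_B ⊗ μ_A)` on `(B ⊗ B) ⊗ (A ⊗ A)`. -/
def twistLHS (τ : B ⊗[𝕜] A →ₗ[𝕜] A ⊗[𝕜] B) :
    (B ⊗[𝕜] B) ⊗[𝕜] (A ⊗[𝕜] A) →ₗ[𝕜] A ⊗[𝕜] B :=
  τ ∘ₗ TensorProduct.map (LinearMap.mul' 𝕜 B) (LinearMap.mul' 𝕜 A)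

/-- `(μ_A ⊗ μ_B) ∘ (1_A ⊗ τ ⊗ 1_B) ∘ (τ ⊗ τ) ∘ (1_B ⊗ τ ⊗ 1_A)` on `(B ⊗ B) ⊗ (A ⊗ A)`. -/
def twistRHS (τ : B ⊗[𝕜] A →ₗ[𝕜] A ⊗[𝕜] B) :
    (B ⊗[𝕜] B) ⊗[𝕜] (A ⊗[𝕜] A) →ₗ[𝕜] A ⊗[𝕜] B :=
  TensorProduct.map (LinearMap.mul' 𝕜 A) (LinearMap.mul' 𝕜 B)
    ∘ₗ (TensorProduct.assoc 𝕜 A A (B ⊗[𝕜] B)).symm.toLinearMap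
    ∘ₗ LinearMap.lTensor A (TensorProduct.assoc 𝕜 A B B).toLinearMap
    ∘ₗ LinearMap.lTensor A (LinearMap.rTensor B τ)
    ∘ₗ LinearMap.lTensor A (TensorProduct.assoc 𝕜 B A B).symm.toLinearMap
    ∘ₗ (TensorProduct.assoc 𝕜 A B (A ⊗[𝕜] B)).toLinearMap
    ∘ₗ TensorProduct.map τ τ
    ∘ₗ (TensorProduct.assoc 𝕜 B A (B ⊗[𝕜] A)).symm.toLinearMap
    ∘ₗ LinearMap.lTensor B (TensorProduct.assoc 𝕜 A B A).toLinearMap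
    ∘ₗ LinearMap.lTensor B (LinearMap.rTensor A τ)
    ∘ₗ LinearMap.lTensor B (TensorProduct.assoc 𝕜 B A A).symm.toLinearMap
    ∘ₗ (TensorProduct.assoc 𝕜 B B (A ⊗[𝕜] A)).toLinearMap

/-- `τ : B ⊗ A → A ⊗ B` is an (algebra) twisting map: it satisfies the unital twisting
conditions and `τ(μ_B ⊗ μ_A) = (μ_A ⊗ μ_B)(1_A ⊗ τ ⊗ 1_B)(τ ⊗ τ)(1_B ⊗ τ ⊗ 1_A)`. -/
def IsTwisting (τ : B ⊗[𝕜] A →ₗ[𝕜] A ⊗[𝕜] B) : Prop :=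
  (∀ a : A, τ ((1 : B) ⊗ₜ[𝕜] a) = a ⊗ₜ[𝕜] (1 : B)) ∧
  (∀ b : B, τ (b ⊗ₜ[𝕜] (1 : A)) = (1 : A) ⊗ₜ[𝕜] b) ∧
  twistLHS 𝕜 A B τ = twistRHS 𝕜 A B τ

/-- `τ` preserves the Künneth grading. -/
def IsGradedMapBA (𝒜 : ℕ → Submodule 𝕜 A) (ℬ : ℕ → Submodule 𝕜 B)
    (τ : B ⊗[𝕜] A →ₗ[𝕜] A ⊗[𝕜] B) : Prop :=
  ∀ n, Submodule.map τ (kunneth 𝕜 ℬ 𝒜 n) ≤ kunneth 𝕜 𝒜 ℬ n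

/-- `τ` is a graded twisting map. -/
def IsGradedTwisting (𝒜 : ℕ → Submodule 𝕜 A) (ℬ : ℕ → Submodule 𝕜 B)
    (τ : B ⊗[𝕜] A →ₗ[𝕜] A ⊗[𝕜] B) : Prop :=
  IsTwisting 𝕜 A B τ ∧ IsGradedMapBA 𝕜 A B 𝒜 ℬ τ

/-- A graded linear map `τ` is graded twisting to degree `n`:  it satisfies the unital
conditions and the twisting identity in all (Künneth) degrees `≤ n`. -/
def TwistingToDeg (𝒜 : ℕ → Submodule 𝕜 A) (ℬ : ℕ → Submodule 𝕜 B)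
    (τ : B ⊗[𝕜] A →ₗ[𝕜] A ⊗[𝕜] B) (n : ℕ) : Prop :=
  IsGradedMapBA 𝕜 A B 𝒜 ℬ τ ∧
  (∀ j ≤ n, ∀ a ∈ 𝒜 j, τ ((1 : B) ⊗ₜ[𝕜] a) = a ⊗ₜ[𝕜] (1 : B)) ∧
  (∀ j ≤ n, ∀ b ∈ ℬ j, τ (b ⊗ₜ[𝕜] (1 : A)) = (1 : A) ⊗ₜ[𝕜] b) ∧
  (∀ j ≤ n, ∀ x ∈ kunneth 𝕜 (kunneth 𝕜 ℬ ℬ) (kunneth 𝕜 𝒜 𝒜) j,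
    twistLHS 𝕜 A B τ x = twistRHS 𝕜 A B τ x)

/-- The unique extension property of a graded twisting map:  for every `n ≥ 3`, any
linear map `τ'` that is graded twisting to degree `n` and agrees with `τ` in all degrees
`< n` also agrees with `τ` in degree `n`. -/
def UEP (𝒜 : ℕ → Submodule 𝕜 A) (ℬ : ℕ → Submodule 𝕜 B)
    (τ : B ⊗[𝕜] A →ₗ[𝕜] A ⊗[𝕜] B) : Prop :=
  ∀ n, 3 ≤ n → ∀ τ' : B ⊗[𝕜] A →ₗ[𝕜] A ⊗[𝕜] B,
    TwistingToDeg 𝕜 A B 𝒜 ℬ τ' n →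
    (∀ i < n, ∀ x ∈ kunneth 𝕜 ℬ 𝒜 i, τ' x = τ x) →
    ∀ x ∈ kunneth 𝕜 ℬ 𝒜 n, τ' x = τ x

/-- The multiplication `μ_τ = (μ_A ⊗ μ_B)(1_A ⊗ τ ⊗ 1_B)` on `A ⊗ B`. -/
def mulTau (τ : B ⊗[𝕜] A →ₗ[𝕜] A ⊗[𝕜] B) :
    (A ⊗[𝕜] B) ⊗[𝕜] (A ⊗[𝕜] B) →ₗ[𝕜] A ⊗[𝕜] B :=
  TensorProduct.map (LinearMap.mul' 𝕜 A) (LinearMap.mul' 𝕜 B)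
    ∘ₗ (TensorProduct.assoc 𝕜 A A (B ⊗[𝕜] B)).symm.toLinearMap
    ∘ₗ LinearMap.lTensor A (TensorProduct.assoc 𝕜 A B B).toLinearMap
    ∘ₗ LinearMap.lTensor A (LinearMap.rTensor B τ)
    ∘ₗ LinearMap.lTensor A (TensorProduct.assoc 𝕜 B A B).symm.toLinearMap
    ∘ₗ (TensorProduct.assoc 𝕜 A B (A ⊗[𝕜] B)).toLinearMap

/-- `(C, ψ)` realizes the twisted tensor product algebra `A ⊗_τ B`:  `ψ` is a linear
isomorphism carrying the multiplication `μ_τ` and its unit to those of `C`. -/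
def Realizes (τ : B ⊗[𝕜] A →ₗ[𝕜] A ⊗[𝕜] B) (C : Type) [Ring C] [Algebra 𝕜 C]
    (ψ : A ⊗[𝕜] B →ₗ[𝕜] C) : Prop :=
  Function.Bijective ψ ∧ ψ ((1 : A) ⊗ₜ[𝕜] (1 : B)) = 1 ∧
  ∀ x y : A ⊗[𝕜] B, ψ (mulTau 𝕜 A B τ (x ⊗ₜ[𝕜] y)) = ψ x * ψ y

/-- The two-sided ideal generated by a subset, as a `𝕜`-submodule. -/
def idealSpan (C : Type) [Ring C] [Algebra 𝕜 C] (s : Set C) : Submodule 𝕜 C :=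
  Submodule.span 𝕜 {x | ∃ c d r, r ∈ s ∧ x = c * r * d}

/-- Weight grading of the tensor algebra. -/
def tensorWeight (V : Type) [AddCommGroup V] [Module 𝕜 V] (n : ℕ) :
    Submodule 𝕜 (TensorAlgebra 𝕜 V) :=
  LinearMap.range (TensorAlgebra.ι 𝕜 (M := V)) ^ n

instance (V : Type) [AddCommGroup V] [Module 𝕜 V] : GradedAlgebra (tensorWeight 𝕜 V) :=
  inferInstanceAs (GradedAlgebra
    ((LinearMap.range (TensorAlgebra.ι 𝕜 : V →ₗ[𝕜] TensorAlgebra 𝕜 V) ^ ·) : ℕ → Submodule 𝕜 _))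

/-- The canonical map `T(C₁) → C` for a graded algebra `C`. -/
def canMap (C : Type) [Ring C] [Algebra 𝕜 C] (𝒞 : ℕ → Submodule 𝕜 C) :
    TensorAlgebra 𝕜 ↥(𝒞 1) →ₐ[𝕜] C :=
  TensorAlgebra.lift 𝕜 (𝒞 1).subtype

/-- `C` (with grading `𝒞`) is a quadratic algebra: the canonical map `T(C₁) → C` is
surjective and its kernel is generated, as a two-sided ideal, by its degree 2 part. -/
def IsQuadraticAlg (C : Type) [Ring C] [Algebra 𝕜 C] (𝒞 : ℕ → Submodule 𝕜 C) : Prop :=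
  Function.Surjective (canMap 𝕜 C 𝒞) ∧
  LinearMap.ker (canMap 𝕜 C 𝒞).toLinearMap =
    idealSpan 𝕜 (TensorAlgebra 𝕜 ↥(𝒞 1))
      ((LinearMap.ker (canMap 𝕜 C 𝒞).toLinearMap ⊓ tensorWeight 𝕜 ↥(𝒞 1) 2 : Submodule 𝕜 _) : Set _)

/-- The left ideal generated by the positive part of a graded algebra. -/
def augIdeal (C : Type) [Ring C] [Algebra 𝕜 C] (𝒞 : ℕ → Submodule 𝕜 C) : Submodule C C :=
  Submodule.span C {x : C | ∃ i, 0 < i ∧ x ∈ 𝒞 i}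

/-- The degree `n` component of the graded free module on generators `σ` in degree `i`. -/
def freeGrade (C : Type) [Ring C] [Algebra 𝕜 C] (𝒞 : ℕ → Submodule 𝕜 C)
    (i : ℕ) (σ : Type) (n : ℕ) : Submodule 𝕜 (σ →₀ C) :=
  ⨅ (j : σ), Submodule.comap (Finsupp.lapply j : (σ →₀ C) →ₗ[𝕜] C)
    (if i ≤ n then 𝒞 (n - i) else ⊥)

/-- `C` (with grading `𝒞`) is a Koszul algebra: the trivial module `𝕜 = C/C₊` admits a
resolution by graded free modules with the `i`-th term generated in degree `i`. -/
def IsKoszul (C : Type) [Ring C] [Algebra 𝕜 C] (𝒞 : ℕ → Submodule 𝕜 C) : Prop :=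
  ∃ (σ : ℕ → Type) (d : ∀ i : ℕ, ((σ (i + 1)) →₀ C) →ₗ[C] ((σ i) →₀ C))
    (ε : ((σ 0) →₀ C) →ₗ[C] (C ⧸ augIdeal 𝕜 C 𝒞)),
    Function.Surjective ε ∧
    LinearMap.ker ε = LinearMap.range (d 0) ∧
    (∀ i, LinearMap.ker (d i) = LinearMap.range (d (i + 1))) ∧
    (∀ i n, ∀ x ∈ freeGrade 𝕜 C 𝒞 (i + 1) (σ (i + 1)) n, d i x ∈ freeGrade 𝕜 C 𝒞 i (σ i) n) ∧
    (∀ n, 0 < n → ∀ x ∈ freeGrade 𝕜 C 𝒞 0 (σ 0) n, ε x = 0)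

/-- `(P, ιA, ιB)` is a free product (coproduct) of `A` and `B`. -/
def IsFreeProduct (P : Type) [Ring P] [Algebra 𝕜 P] (ιA : A →ₐ[𝕜] P) (ιB : B →ₐ[𝕜] P) :
    Prop :=
  ∀ (C : Type) [Ring C] [Algebra 𝕜 C], ∀ (f : A →ₐ[𝕜] C) (g : B →ₐ[𝕜] C),
    ∃! h : P →ₐ[𝕜] C, h.comp ιA = f ∧ h.comp ιB = g

/-- The linear map `A ⊗ B → P`, `a ⊗ b ↦ ιA(a) · ιB(b)`. -/
def mulMapP (P : Type) [Ring P] [Algebra 𝕜 P] (ιA : A →ₐ[𝕜] P) (ιB : B →ₐ[𝕜] P) :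
    A ⊗[𝕜] B →ₗ[𝕜] P :=
  TensorProduct.lift (LinearMap.mk₂ 𝕜 (fun a b => ιA a * ιB b)
    (fun a a' b => by simp [map_add, add_mul])
    (fun c a b => by simp [map_smul, smul_mul_assoc])
    (fun a b b' => by simp [map_add, mul_add])
    (fun c a b => by simp [map_smul, mul_smul_comm]))

/-- The set of `τ`-relations `b ⊗ a - τ(b ⊗ a)` of total degree at most `n`,
inside the free product `P`. -/
def relSetLe (P : Type) [Ring P] [Algebra 𝕜 P] (ιA : A →ₐ[𝕜] P) (ιB : B →ₐ[𝕜] P)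
    (𝒜 : ℕ → Submodule 𝕜 A) (ℬ : ℕ → Submodule 𝕜 B)
    (τ : B ⊗[𝕜] A →ₗ[𝕜] A ⊗[𝕜] B) (n : ℕ) : Set P :=
  {x | ∃ i j a b, i + j ≤ n ∧ a ∈ 𝒜 i ∧ b ∈ ℬ j ∧
    x = ιB b * ιA a - mulMapP 𝕜 A B P ιA ιB (τ (b ⊗ₜ[𝕜] a))}

/-- The set of all `τ`-relations `b ⊗ a - τ(b ⊗ a)` inside the free product `P`. -/
def relSetAll (P : Type) [Ring P] [Algebra 𝕜 P] (ιA : A →ₐ[𝕜] P) (ιB : B →ₐ[𝕜] P)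
    (τ : B ⊗[𝕜] A →ₗ[𝕜] A ⊗[𝕜] B) : Set P :=
  {x | ∃ a b, x = ιB b * ιA a - mulMapP 𝕜 A B P ιA ιB (τ (b ⊗ₜ[𝕜] a))}

/-- The (Künneth) grading on the free product `P` of the graded algebras `A` and `B`. -/
def freeProdGrade (P : Type) [Ring P] [Algebra 𝕜 P] (ιA : A →ₐ[𝕜] P) (ιB : B →ₐ[𝕜] P)
    (𝒜 : ℕ → Submodule 𝕜 A) (ℬ : ℕ → Submodule 𝕜 B) (n : ℕ) : Submodule 𝕜 P :=
  ⨆ (l : List ℕ) (_ : l.sum = n),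
    ((l.map (fun i => Submodule.map ιA.toLinearMap (𝒜 i) ⊔ Submodule.map ιB.toLinearMap (ℬ i))).foldr
      (· * ·) 1)

end TTP

namespace TTP

open Polynomial

/-- The grading of `𝕜[x]` by degree: the degree `n` component is spanned by `x^n`. -/
def polyGrade (𝕜 : Type) [Field 𝕜] : ℕ → Submodule 𝕜 (Polynomial 𝕜) :=
  fun n => Submodule.span 𝕜 {(X : Polynomial 𝕜) ^ n}

/-- The polynomials `S_n(t)`:  `S₁(t) = 1`, `S₂(t) = 1`, and
`S_n(t) = S_{n-1}(t) - t·S_{n-2}(t)` for `n ≥ 3`. -/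
def S (𝕜 : Type) [Field 𝕜] : ℕ → Polynomial 𝕜
  | 0 => 0
  | 1 => 1
  | 2 => 1
  | (n + 3) => S 𝕜 (n + 2) - Polynomial.X * S 𝕜 (n + 1)

/-- The defining conditions for the twisting map of Statement 18:  `τ` satisfies the
unital twisting conditions, and
`τ(y^i ⊗ x^j) = S_{i+j}(c)⁻¹ (S_j(c) x^{i+j} ⊗ 1 + c^j S_i(c) 1 ⊗ y^{i+j})` for `i, j ≥ 1`. -/
def conds18 (𝕜 : Type) [Field 𝕜] (c : 𝕜)
    (τ : (Polynomial 𝕜) ⊗[𝕜] (Polynomial 𝕜) →ₗ[𝕜] (Polynomial 𝕜) ⊗[𝕜] (Polynomial 𝕜)) :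
    Prop :=
  (∀ p : Polynomial 𝕜, τ (p ⊗ₜ[𝕜] (1 : Polynomial 𝕜)) = (1 : Polynomial 𝕜) ⊗ₜ[𝕜] p) ∧
  (∀ p : Polynomial 𝕜, τ ((1 : Polynomial 𝕜) ⊗ₜ[𝕜] p) = p ⊗ₜ[𝕜] (1 : Polynomial 𝕜)) ∧
  (∀ i j : ℕ, 1 ≤ i → 1 ≤ j →
    τ (((X : Polynomial 𝕜) ^ i) ⊗ₜ[𝕜] ((X : Polynomial 𝕜) ^ j)) =
      ((S 𝕜 (i + j)).eval c)⁻¹ •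
        (((S 𝕜 j).eval c) • (((X : Polynomial 𝕜) ^ (i + j)) ⊗ₜ[𝕜] (1 : Polynomial 𝕜)) +
          (c ^ j * (S 𝕜 i).eval c) •
            ((1 : Polynomial 𝕜) ⊗ₜ[𝕜] ((X : Polynomial 𝕜) ^ (i + j)))))

section Sequence

variable {𝕜 : Type} [Field 𝕜]

lemma S_eval_add_two (c : 𝕜) (n : ℕ) :
    (S 𝕜 (n + 2)).eval c = (S 𝕜 (n + 1)).eval c - c * (S 𝕜 n).eval c := by
  cases n <;> simp [S]

/-- A Catalan-type identity for the sequence `S_n(c)`. -/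
lemma S_eval_catalan (c : 𝕜) (k j l : ℕ) :
    (S 𝕜 (k + l)).eval c * (S 𝕜 (j + k)).eval c =
      (S 𝕜 k).eval c * (S 𝕜 (j + k + l)).eval c +
        c ^ k * (S 𝕜 j).eval c * (S 𝕜 l).eval c := by
  induction k generalizing j l with
  | zero => simp [S, mul_comm]
  | succ k ih =>
    induction j using Nat.twoStepInduction with
    | zero => simp [S, mul_comm]
    | one =>
      have h2 := ih 1 l
      have e1 := S_eval_add_two c k
      have e2 := S_eval_add_two c (k + l)
      have S1 : (S 𝕜 1).eval c = 1 := by simp [S]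
      rw [show 1 + (k + 1) + l = k + l + 2 by ring, show 1 + (k + 1) = k + 2 by ring,
        show k + 1 + l = k + l + 1 by ring, e1, e2, S1]
      rw [show 1 + k + l = k + l + 1 by ring, show 1 + k = k + 1 by ring, S1] at h2
      linear_combination c * h2
    | more j ih0 ih1 =>
      have e1 := S_eval_add_two c (j + (k + 1))
      have e2 := S_eval_add_two c (j + (k + 1) + l)
      have e3 := S_eval_add_two c j
      rw [show j + 2 + (k + 1) + l = j + (k + 1) + l + 2 by ring,
        show j + 2 + (k + 1) = j + (k + 1) + 2 by ring, e1, e2, e3]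
      rw [show j + 1 + (k + 1) + l = j + (k + 1) + l + 1 by ring,
        show j + 1 + (k + 1) = j + (k + 1) + 1 by ring] at ih1
      linear_combination ih1 - c * ih0

/-- The coefficient of `x^{i+j} ⊗ 1` in `τ(y^i ⊗ x^j)`. -/
def coeffX (c : 𝕜) (i j : ℕ) : 𝕜 :=
  if i + j = 0 then 1 else ((S 𝕜 (i + j)).eval c)⁻¹ * (S 𝕜 j).eval c

/-- The coefficient of `1 ⊗ y^{i+j}` in `τ(y^i ⊗ x^j)`. -/
def coeffY (c : 𝕜) (i j : ℕ) : 𝕜 :=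
  ((S 𝕜 (i + j)).eval c)⁻¹ * (c ^ j * (S 𝕜 i).eval c)

lemma coeffX_of_pos (c : 𝕜) {i j : ℕ} (h : 0 < i + j) :
    coeffX c i j = ((S 𝕜 (i + j)).eval c)⁻¹ * (S 𝕜 j).eval c :=
  if_neg h.ne'

lemma coeffX_zero_left {c : 𝕜} (hc : ∀ n : ℕ, 1 ≤ n → (S 𝕜 n).eval c ≠ 0) (j : ℕ) :
    coeffX c 0 j = 1 := by
  rcases Nat.eq_zero_or_pos j with rfl | h
  · simp [coeffX]
  · rw [coeffX_of_pos c (by omega), zero_add, inv_mul_cancel₀ (hc j h)]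

lemma coeffX_zero_right (c : 𝕜) {i : ℕ} (h : 0 < i) : coeffX c i 0 = 0 := by
  rw [coeffX_of_pos c (by omega)]
  simp [S]

lemma coeffY_zero_left (c : 𝕜) (j : ℕ) : coeffY c 0 j = 0 := by
  simp [coeffY, S]

lemma coeffY_zero_right {c : 𝕜} (hc : ∀ n : ℕ, 1 ≤ n → (S 𝕜 n).eval c ≠ 0) {i : ℕ}
    (h : 0 < i) : coeffY c i 0 = 1 := by
  simp [coeffY, inv_mul_cancel₀ (hc i h)]

lemma coeffX_twist {c : 𝕜} (hc : ∀ n : ℕ, 1 ≤ n → (S 𝕜 n).eval c ≠ 0) (i j k l : ℕ) :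
    coeffX c (i + j) (k + l) =
      coeffX c j k * (coeffX c i (j + k) + coeffY c i (j + k) * coeffX c (i + (j + k)) l) +
        coeffY c j k * (coeffX c (j + k) l * coeffX c i (j + k + l)) := by
  rcases Nat.eq_zero_or_pos (j + k) with h | h
  · obtain ⟨rfl, rfl⟩ : j = 0 ∧ k = 0 := by omega
    rcases Nat.eq_zero_or_pos i with rfl | hi
    · simp [coeffX_zero_left hc, coeffY_zero_left]
    · simp [coeffX_zero_left hc, coeffY_zero_left, coeffX_zero_right c hi,
        coeffY_zero_right hc hi]
  · have h1 := S_eval_catalan c k j l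
    have h2 := S_eval_catalan c (j + k) i l
    have n1 := hc (j + k) h
    have n2 := hc (i + (j + k)) (by omega)
    have n3 := hc (i + (j + k) + l) (by omega)
    have n4 := hc (j + k + l) (by omega)
    rw [coeffX_of_pos c (by omega), coeffX_of_pos c (by omega), coeffX_of_pos c (by omega),
      coeffX_of_pos c (by omega), coeffX_of_pos c (by omega), coeffX_of_pos c (by omega),
      coeffY, coeffY, show i + j + (k + l) = i + (j + k) + l by ring,
      show i + (j + k + l) = i + (j + k) + l by ring]
    field_simp
    linear_combination (S 𝕜 (i + (j + k))).eval c * h1 + (S 𝕜 k).eval c * h2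

lemma coeffY_twist {c : 𝕜} (hc : ∀ n : ℕ, 1 ≤ n → (S 𝕜 n).eval c ≠ 0) (i j k l : ℕ) :
    coeffY c (i + j) (k + l) =
      coeffX c j k * (coeffY c i (j + k) * coeffY c (i + (j + k)) l) +
        coeffY c j k * (coeffX c (j + k) l * coeffY c i (j + k + l) + coeffY c (j + k) l) := by
  rcases Nat.eq_zero_or_pos (j + k) with h | h
  · obtain ⟨rfl, rfl⟩ : j = 0 ∧ k = 0 := by omega
    rcases Nat.eq_zero_or_pos i with rfl | hi
    · simp [coeffY_zero_left]
    · simp [coeffX_zero_left hc, coeffY_zero_left, coeffY_zero_right hc hi]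
  · have h1 := S_eval_catalan c j i k
    have h2 := S_eval_catalan c (j + k) i l
    have n1 := hc (j + k) h
    have n2 := hc (i + (j + k)) (by omega)
    have n3 := hc (i + (j + k) + l) (by omega)
    have n4 := hc (j + k + l) (by omega)
    rw [coeffX_of_pos c (by omega), coeffX_of_pos c (by omega), coeffY, coeffY, coeffY, coeffY,
      coeffY, coeffY, show i + j + (k + l) = i + (j + k) + l by ring,
      show i + (j + k + l) = i + (j + k) + l by ring]
    rw [show i + j + k = i + (j + k) by ring] at h1
    field_simp
    linear_combination c ^ k * c ^ l * ((S 𝕜 (j + k + l)).eval c * h1 + (S 𝕜 j).eval c * h2)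

end Sequence

section Kunneth

variable {𝕜 : Type} [Field 𝕜]

lemma tmul_mem_kunneth {M N : Type} [AddCommGroup M] [Module 𝕜 M] [AddCommGroup N] [Module 𝕜 N]
    {𝒜 : ℕ → Submodule 𝕜 M} {ℬ : ℕ → Submodule 𝕜 N} {i j : ℕ} {a : M} {b : N}
    (ha : a ∈ 𝒜 i) (hb : b ∈ ℬ j) : a ⊗ₜ[𝕜] b ∈ kunneth 𝕜 𝒜 ℬ (i + j) :=
  Submodule.mem_iSup_of_mem (i, j) <| Submodule.mem_iSup_of_mem rfl
    ⟨(⟨a, ha⟩ : 𝒜 i) ⊗ₜ[𝕜] (⟨b, hb⟩ : ℬ j), by simp⟩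

lemma X_pow_mem_polyGrade (n : ℕ) : (X : 𝕜[X]) ^ n ∈ polyGrade 𝕜 n :=
  Submodule.subset_span rfl

lemma one_mem_polyGrade : (1 : 𝕜[X]) ∈ polyGrade 𝕜 0 := by
  simpa using X_pow_mem_polyGrade (𝕜 := 𝕜) 0

lemma kunneth_polyGrade (n : ℕ) :
    kunneth 𝕜 (polyGrade 𝕜) (polyGrade 𝕜) n =
      Submodule.span 𝕜 {z | ∃ i j, i + j = n ∧ ((X : 𝕜[X]) ^ i) ⊗ₜ[𝕜] ((X : 𝕜[X]) ^ j) = z} := by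
  apply le_antisymm
  · refine iSup₂_le ?_
    rintro ⟨i, j⟩ h
    rintro _ ⟨z, rfl⟩
    induction z with
    | zero => simp
    | add z w hz hw => simpa using add_mem hz hw
    | tmul a b =>
      obtain ⟨r, hr⟩ := Submodule.mem_span_singleton.1 a.2
      obtain ⟨s, hs⟩ := Submodule.mem_span_singleton.1 b.2
      simp only [TensorProduct.map_tmul, Submodule.subtype_apply, ← hr, ← hs,
        TensorProduct.smul_tmul_smul]
      exact Submodule.smul_mem _ _ (Submodule.subset_span ⟨i, j, h, rfl⟩)
  · refine Submodule.span_le.2 ?_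
    rintro _ ⟨i, j, rfl, rfl⟩
    exact tmul_mem_kunneth (X_pow_mem_polyGrade i) (X_pow_mem_polyGrade j)

end Kunneth

section Twist

variable {𝕜 : Type} [Field 𝕜] {A B : Type} [Ring A] [Algebra 𝕜 A] [Ring B] [Algebra 𝕜 B]

lemma mulTau_tmul (τ : B ⊗[𝕜] A →ₗ[𝕜] A ⊗[𝕜] B) (a a' : A) (b b' : B) :
    mulTau 𝕜 A B τ ((a ⊗ₜ b) ⊗ₜ (a' ⊗ₜ b')) =
      TensorProduct.map (LinearMap.mulLeft 𝕜 a) (LinearMap.mulRight 𝕜 b') (τ (b ⊗ₜ a')) := by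
  simp only [mulTau, LinearMap.comp_apply, LinearEquiv.coe_coe, TensorProduct.assoc_tmul,
    TensorProduct.assoc_symm_tmul, LinearMap.lTensor_tmul, LinearMap.rTensor_tmul]
  induction τ (b ⊗ₜ a') with
  | zero => simp
  | add z w hz hw => simp only [TensorProduct.add_tmul, TensorProduct.tmul_add, map_add, hz, hw]
  | tmul x y => simp

/-- The map `z ↦ μ_τ((τ ⊗ τ)(b ⊗ z ⊗ a))`, for `z ∈ A ⊗ B`. -/
def sandwich (τ : B ⊗[𝕜] A →ₗ[𝕜] A ⊗[𝕜] B) (b : B) (a : A) : A ⊗[𝕜] B →ₗ[𝕜] A ⊗[𝕜] B :=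
  mulTau 𝕜 A B τ ∘ₗ
    TensorProduct.map (τ ∘ₗ TensorProduct.mk 𝕜 B A b) (τ ∘ₗ (TensorProduct.mk 𝕜 B A).flip a)

lemma sandwich_tmul (τ : B ⊗[𝕜] A →ₗ[𝕜] A ⊗[𝕜] B) (b y : B) (a x : A) :
    sandwich τ b a (x ⊗ₜ y) = mulTau 𝕜 A B τ (τ (b ⊗ₜ x) ⊗ₜ τ (y ⊗ₜ a)) := by
  simp [sandwich]

lemma twistLHS_tmul (τ : B ⊗[𝕜] A →ₗ[𝕜] A ⊗[𝕜] B) (b b' : B) (a a' : A) :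
    twistLHS 𝕜 A B τ ((b ⊗ₜ b') ⊗ₜ (a ⊗ₜ a')) = τ ((b * b') ⊗ₜ (a * a')) := by
  simp [twistLHS]

lemma twistRHS_tmul (τ : B ⊗[𝕜] A →ₗ[𝕜] A ⊗[𝕜] B) (b b' : B) (a a' : A) :
    twistRHS 𝕜 A B τ ((b ⊗ₜ b') ⊗ₜ (a ⊗ₜ a')) = sandwich τ b a' (τ (b' ⊗ₜ a)) := by
  have h : twistRHS 𝕜 A B τ ((b ⊗ₜ b') ⊗ₜ (a ⊗ₜ a')) =
      mulTau 𝕜 A B τ (TensorProduct.map τ τ ((TensorProduct.assoc 𝕜 B A (B ⊗[𝕜] A)).symm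
        (b ⊗ₜ (TensorProduct.assoc 𝕜 A B A (τ (b' ⊗ₜ a) ⊗ₜ a'))))) := rfl
  rw [h]
  induction τ (b' ⊗ₜ a) with
  | zero => simp
  | add z w hz hw => simp only [TensorProduct.add_tmul, TensorProduct.tmul_add, map_add, hz, hw]
  | tmul x y => simp [sandwich_tmul]

end Twist

section Poly

variable {𝕜 : Type} [Field 𝕜]

lemma twisting_map_apply {c : 𝕜} (hc : ∀ n : ℕ, 1 ≤ n → (S 𝕜 n).eval c ≠ 0)
    {τ : 𝕜[X] ⊗[𝕜] 𝕜[X] →ₗ[𝕜] 𝕜[X] ⊗[𝕜] 𝕜[X]} (h : conds18 𝕜 c τ) (i j : ℕ) :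
    τ ((X ^ i) ⊗ₜ (X ^ j)) =
      coeffX c i j • ((X ^ (i + j)) ⊗ₜ[𝕜] (1 : 𝕜[X])) +
        coeffY c i j • ((1 : 𝕜[X]) ⊗ₜ[𝕜] (X ^ (i + j))) := by
  rcases Nat.eq_zero_or_pos i with rfl | hi
  · simp [h.2.1, coeffX_zero_left hc, coeffY_zero_left]
  rcases Nat.eq_zero_or_pos j with rfl | hj
  · simp [h.1, coeffX_zero_right c hi, coeffY_zero_right hc hi]
  rw [h.2.2 i j hi hj, coeffX_of_pos c (by omega), coeffY, smul_add, smul_smul, smul_smul]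

lemma exists_twisting_map {c : 𝕜} (hc : ∀ n : ℕ, 1 ≤ n → (S 𝕜 n).eval c ≠ 0) :
    ∃ τ : 𝕜[X] ⊗[𝕜] 𝕜[X] →ₗ[𝕜] 𝕜[X] ⊗[𝕜] 𝕜[X], conds18 𝕜 c τ := by
  let τ : 𝕜[X] ⊗[𝕜] 𝕜[X] →ₗ[𝕜] 𝕜[X] ⊗[𝕜] 𝕜[X] :=
    ((basisMonomials 𝕜).tensorProduct (basisMonomials 𝕜)).constr 𝕜 fun ij =>
      coeffX c ij.1 ij.2 • ((X ^ (ij.1 + ij.2)) ⊗ₜ[𝕜] (1 : 𝕜[X])) +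
        coeffY c ij.1 ij.2 • ((1 : 𝕜[X]) ⊗ₜ[𝕜] (X ^ (ij.1 + ij.2)))
  have hτ : ∀ i j, τ ((X ^ i) ⊗ₜ (X ^ j)) =
      coeffX c i j • ((X ^ (i + j)) ⊗ₜ[𝕜] (1 : 𝕜[X])) +
        coeffY c i j • ((1 : 𝕜[X]) ⊗ₜ[𝕜] (X ^ (i + j))) := by
    intro i j
    have := ((basisMonomials 𝕜).tensorProduct (basisMonomials 𝕜)).constr_basis 𝕜 (fun ij =>
      coeffX c ij.1 ij.2 • ((X ^ (ij.1 + ij.2)) ⊗ₜ[𝕜] (1 : 𝕜[X])) +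
        coeffY c ij.1 ij.2 • ((1 : 𝕜[X]) ⊗ₜ[𝕜] (X ^ (ij.1 + ij.2)))) (i, j)
    simpa [Module.Basis.tensorProduct_apply, monomial_one_right_eq_X_pow] using this
  refine ⟨τ, fun p => ?_, fun p => ?_, fun i j hi hj => ?_⟩
  · induction p using Polynomial.induction_on' with
    | add p q hp hq => rw [TensorProduct.add_tmul, map_add, hp, hq, TensorProduct.tmul_add]
    | monomial i r =>
      rw [← mul_one r, ← smul_eq_mul, ← smul_monomial, monomial_one_right_eq_X_pow,
        ← TensorProduct.smul_tmul', map_smul, TensorProduct.tmul_smul, ← pow_zero X, hτ]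
      rcases Nat.eq_zero_or_pos i with rfl | hi
      · simp [coeffX_zero_left hc, coeffY_zero_left]
      · simp [coeffX_zero_right c hi, coeffY_zero_right hc hi]
  · induction p using Polynomial.induction_on' with
    | add p q hp hq => rw [TensorProduct.tmul_add, map_add, hp, hq, TensorProduct.add_tmul]
    | monomial i r =>
      rw [← mul_one r, ← smul_eq_mul, ← smul_monomial, monomial_one_right_eq_X_pow,
        ← TensorProduct.smul_tmul', TensorProduct.tmul_smul, map_smul, ← pow_zero X, hτ]
      simp [coeffX_zero_left hc, coeffY_zero_left]
  · rw [hτ, coeffX_of_pos c (by omega), coeffY, smul_add, smul_smul, smul_smul]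

lemma isTwisting_of_conds {c : 𝕜} (hc : ∀ n : ℕ, 1 ≤ n → (S 𝕜 n).eval c ≠ 0)
    {τ : 𝕜[X] ⊗[𝕜] 𝕜[X] →ₗ[𝕜] 𝕜[X] ⊗[𝕜] 𝕜[X]} (h : conds18 𝕜 c τ) :
    IsTwisting 𝕜 𝕜[X] 𝕜[X] τ := by
  refine ⟨h.2.1, h.1, ?_⟩
  let b := basisMonomials 𝕜
  refine ((b.tensorProduct b).tensorProduct (b.tensorProduct b)).ext ?_
  rintro ⟨⟨i, j⟩, k, l⟩
  simp only [b, Module.Basis.tensorProduct_apply, coe_basisMonomials,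
    monomial_one_right_eq_X_pow, twistLHS_tmul, twistRHS_tmul, ← pow_add]
  have hτ := twisting_map_apply hc h
  have u1 := h.1
  have u2 := h.2.1
  rw [hτ j k]
  simp only [map_add, map_smul, sandwich_tmul, u1, u2, hτ, TensorProduct.add_tmul,
    TensorProduct.tmul_add, ← TensorProduct.smul_tmul', TensorProduct.tmul_smul, mulTau_tmul,
    TensorProduct.map_tmul, LinearMap.mulLeft_apply, LinearMap.mulRight_apply, one_mul, mul_one,
    ← pow_add]
  rw [show i + j + (k + l) = i + (j + k) + l by ring, show i + (j + k + l) = i + (j + k) + l by ring,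
    coeffX_twist hc, coeffY_twist hc]
  module

lemma isGradedMap_of_conds {c : 𝕜} (hc : ∀ n : ℕ, 1 ≤ n → (S 𝕜 n).eval c ≠ 0)
    {τ : 𝕜[X] ⊗[𝕜] 𝕜[X] →ₗ[𝕜] 𝕜[X] ⊗[𝕜] 𝕜[X]} (h : conds18 𝕜 c τ) :
    IsGradedMapBA 𝕜 𝕜[X] 𝕜[X] (polyGrade 𝕜) (polyGrade 𝕜) τ := by
  intro n
  conv_lhs => rw [kunneth_polyGrade]
  rw [Submodule.map_span_le]
  rintro _ ⟨i, j, rfl, rfl⟩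
  rw [twisting_map_apply hc h]
  exact add_mem
    (Submodule.smul_mem _ _
      (by simpa using tmul_mem_kunneth (X_pow_mem_polyGrade (i + j)) (one_mem_polyGrade (𝕜 := 𝕜))))
    (Submodule.smul_mem _ _
      (by simpa using tmul_mem_kunneth (one_mem_polyGrade (𝕜 := 𝕜)) (X_pow_mem_polyGrade (i + j))))

lemma IsGradedTwisting.twistingToDeg {A B : Type} [Ring A] [Algebra 𝕜 A] [Ring B] [Algebra 𝕜 B]
    {𝒜 : ℕ → Submodule 𝕜 A} {ℬ : ℕ → Submodule 𝕜 B} {τ : B ⊗[𝕜] A →ₗ[𝕜] A ⊗[𝕜] B}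
    (h : IsGradedTwisting 𝕜 A B 𝒜 ℬ τ) (n : ℕ) : TwistingToDeg 𝕜 A B 𝒜 ℬ τ n :=
  ⟨h.2, fun _ _ a _ => h.1.1 a, fun _ _ b _ => h.1.2.1 b, fun _ _ x _ => by rw [h.1.2.2]⟩

variable {n : ℕ} {σ : 𝕜[X] ⊗[𝕜] 𝕜[X] →ₗ[𝕜] 𝕜[X] ⊗[𝕜] 𝕜[X]}

lemma TwistingToDeg.one_tmul_X_pow
    (h : TwistingToDeg 𝕜 𝕜[X] 𝕜[X] (polyGrade 𝕜) (polyGrade 𝕜) σ n) {j : ℕ} (hj : j ≤ n) :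
    σ (1 ⊗ₜ (X ^ j)) = (X ^ j) ⊗ₜ 1 :=
  h.2.1 j hj _ (X_pow_mem_polyGrade j)

lemma TwistingToDeg.X_pow_tmul_one
    (h : TwistingToDeg 𝕜 𝕜[X] 𝕜[X] (polyGrade 𝕜) (polyGrade 𝕜) σ n) {j : ℕ} (hj : j ≤ n) :
    σ ((X ^ j) ⊗ₜ 1) = 1 ⊗ₜ (X ^ j) :=
  h.2.2.1 j hj _ (X_pow_mem_polyGrade j)

lemma TwistingToDeg.one_tmul_one
    (h : TwistingToDeg 𝕜 𝕜[X] 𝕜[X] (polyGrade 𝕜) (polyGrade 𝕜) σ n) :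
    σ (1 ⊗ₜ 1) = 1 ⊗ₜ 1 := by
  simpa using h.one_tmul_X_pow (Nat.zero_le n)

lemma TwistingToDeg.twist
    (h : TwistingToDeg 𝕜 𝕜[X] 𝕜[X] (polyGrade 𝕜) (polyGrade 𝕜) σ n) {i j k l : ℕ}
    (hn : i + j + (k + l) = n) :
    σ ((X ^ (i + j)) ⊗ₜ (X ^ (k + l))) = sandwich σ (X ^ i) (X ^ l) (σ ((X ^ j) ⊗ₜ (X ^ k))) := by
  rw [pow_add, pow_add, ← twistLHS_tmul, ← twistRHS_tmul]
  exact h.2.2.2 n le_rfl _ (hn ▸ tmul_mem_kunneth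
    (tmul_mem_kunneth (X_pow_mem_polyGrade i) (X_pow_mem_polyGrade j))
    (tmul_mem_kunneth (X_pow_mem_polyGrade k) (X_pow_mem_polyGrade l)))

lemma TwistingToDeg.mulTau_one_right
    (h : TwistingToDeg 𝕜 𝕜[X] 𝕜[X] (polyGrade 𝕜) (polyGrade 𝕜) σ n)
    {z : 𝕜[X] ⊗[𝕜] 𝕜[X]} (hz : z ∈ kunneth 𝕜 (polyGrade 𝕜) (polyGrade 𝕜) n) :
    mulTau 𝕜 𝕜[X] 𝕜[X] σ (z ⊗ₜ (1 ⊗ₜ 1)) = z := by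
  rw [kunneth_polyGrade] at hz
  induction hz using Submodule.span_induction with
  | mem z hz =>
    obtain ⟨i, j, hij, rfl⟩ := hz
    rw [mulTau_tmul, h.X_pow_tmul_one (by omega)]
    simp
  | zero => simp
  | add z w _ _ hz hw => rw [TensorProduct.add_tmul, map_add, hz, hw]
  | smul r z _ hz => rw [← TensorProduct.smul_tmul', map_smul, hz]

lemma TwistingToDeg.mulTau_one_left
    (h : TwistingToDeg 𝕜 𝕜[X] 𝕜[X] (polyGrade 𝕜) (polyGrade 𝕜) σ n)
    {z : 𝕜[X] ⊗[𝕜] 𝕜[X]} (hz : z ∈ kunneth 𝕜 (polyGrade 𝕜) (polyGrade 𝕜) n) :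
    mulTau 𝕜 𝕜[X] 𝕜[X] σ ((1 ⊗ₜ 1) ⊗ₜ z) = z := by
  rw [kunneth_polyGrade] at hz
  induction hz using Submodule.span_induction with
  | mem z hz =>
    obtain ⟨i, j, hij, rfl⟩ := hz
    rw [mulTau_tmul, h.one_tmul_X_pow (by omega)]
    simp
  | zero => simp
  | add z w _ _ hz hw => rw [TensorProduct.tmul_add, map_add, hz, hw]
  | smul r z _ hz => rw [TensorProduct.tmul_smul, map_smul, hz]

lemma TwistingToDeg.apply_mem
    (h : TwistingToDeg 𝕜 𝕜[X] 𝕜[X] (polyGrade 𝕜) (polyGrade 𝕜) σ n) {i j : ℕ} (hij : i + j = n) :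
    σ ((X ^ i) ⊗ₜ (X ^ j)) ∈ kunneth 𝕜 (polyGrade 𝕜) (polyGrade 𝕜) n :=
  h.1 n (Submodule.mem_map_of_mem
    (hij ▸ tmul_mem_kunneth (X_pow_mem_polyGrade i) (X_pow_mem_polyGrade j)))

lemma TwistingToDeg.apply_add_left
    (h : TwistingToDeg 𝕜 𝕜[X] 𝕜[X] (polyGrade 𝕜) (polyGrade 𝕜) σ n) {i j k : ℕ}
    (hn : i + j + k = n) {p q : 𝕜}
    (hσ : σ ((X ^ j) ⊗ₜ (X ^ k)) = p • ((X ^ (j + k)) ⊗ₜ 1) + q • (1 ⊗ₜ (X ^ (j + k)))) :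
    σ ((X ^ (i + j)) ⊗ₜ (X ^ k)) = p • σ ((X ^ i) ⊗ₜ (X ^ (j + k))) + q • (1 ⊗ₜ (X ^ n)) := by
  have := h.twist (i := i) (j := j) (k := k) (l := 0) (by omega)
  rw [add_zero, pow_zero, hσ, map_add, map_smul, map_smul, sandwich_tmul, sandwich_tmul,
    h.one_tmul_one, h.mulTau_one_right (h.apply_mem (by omega)), h.X_pow_tmul_one (by omega),
    h.X_pow_tmul_one (by omega), mulTau_tmul, h.X_pow_tmul_one (by omega)] at this
  simpa [← pow_add, ← add_assoc, hn] using this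

lemma TwistingToDeg.apply_add_right
    (h : TwistingToDeg 𝕜 𝕜[X] 𝕜[X] (polyGrade 𝕜) (polyGrade 𝕜) σ n) {j k l : ℕ}
    (hn : j + k + l = n) {p q : 𝕜}
    (hσ : σ ((X ^ j) ⊗ₜ (X ^ k)) = p • ((X ^ (j + k)) ⊗ₜ 1) + q • (1 ⊗ₜ (X ^ (j + k)))) :
    σ ((X ^ j) ⊗ₜ (X ^ (k + l))) = p • ((X ^ n) ⊗ₜ 1) + q • σ ((X ^ (j + k)) ⊗ₜ (X ^ l)) := by
  have := h.twist (i := 0) (j := j) (k := k) (l := l) (by omega)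
  rw [zero_add, pow_zero, hσ, map_add, map_smul, map_smul, sandwich_tmul, sandwich_tmul,
    h.one_tmul_one, h.mulTau_one_left (h.apply_mem (by omega)), h.one_tmul_X_pow (by omega),
    h.one_tmul_X_pow (by omega), mulTau_tmul, h.one_tmul_X_pow (by omega)] at this
  simpa [← pow_add, hn] using this

/-- Two graded maps twisting to degree `n` which agree with the formula in lower degrees agree on
`y^a ⊗ x^{n-a}` and `y^b ⊗ x^{n-b}` for `0 < b < a < n`. -/
lemma TwistingToDeg.eq_of_lt {c : 𝕜} (hc : ∀ n : ℕ, 1 ≤ n → (S 𝕜 n).eval c ≠ 0)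
    {τ : 𝕜[X] ⊗[𝕜] 𝕜[X] →ₗ[𝕜] 𝕜[X] ⊗[𝕜] 𝕜[X]}
    (hτ : TwistingToDeg 𝕜 𝕜[X] 𝕜[X] (polyGrade 𝕜) (polyGrade 𝕜) τ n)
    (hσ : TwistingToDeg 𝕜 𝕜[X] 𝕜[X] (polyGrade 𝕜) (polyGrade 𝕜) σ n)
    (eτ : ∀ i j, i + j < n → τ ((X ^ i) ⊗ₜ (X ^ j)) =
      coeffX c i j • ((X ^ (i + j)) ⊗ₜ[𝕜] (1 : 𝕜[X])) +
        coeffY c i j • ((1 : 𝕜[X]) ⊗ₜ[𝕜] (X ^ (i + j))))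
    (eσ : ∀ i j, i + j < n → σ ((X ^ i) ⊗ₜ (X ^ j)) =
      coeffX c i j • ((X ^ (i + j)) ⊗ₜ[𝕜] (1 : 𝕜[X])) +
        coeffY c i j • ((1 : 𝕜[X]) ⊗ₜ[𝕜] (X ^ (i + j))))
    {b d e : ℕ} (hb : 0 < b) (hd : 0 < d) (he : 0 < e) (hn : b + d + e = n) :
    σ ((X ^ (b + d)) ⊗ₜ (X ^ e)) = τ ((X ^ (b + d)) ⊗ₜ (X ^ e)) ∧
      σ ((X ^ b) ⊗ₜ (X ^ (d + e))) = τ ((X ^ b) ⊗ₜ (X ^ (d + e))) := by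
  have l1 := hσ.apply_add_left hn (eσ d e (by omega))
  have l2 := hτ.apply_add_left hn (eτ d e (by omega))
  have r1 := hσ.apply_add_right hn (eσ b d (by omega))
  have r2 := hτ.apply_add_right hn (eτ b d (by omega))
  have key : coeffX c d e * coeffY c b d ≠ 1 := by
    have h1 := S_eval_catalan c d b e
    have n1 := hc (d + e) (by omega)
    have n2 := hc (b + d) (by omega)
    rw [coeffX_of_pos c (by omega), coeffY]
    field_simp
    intro h2
    rw [div_eq_one_iff_eq (mul_ne_zero n1 n2)] at h2
    refine mul_ne_zero (hc d hd) (hc (b + d + e) (by omega)) ?_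
    linear_combination -h2 - h1
  have hl : σ ((X ^ (b + d)) ⊗ₜ (X ^ e)) - τ ((X ^ (b + d)) ⊗ₜ (X ^ e)) =
      coeffX c d e • (σ ((X ^ b) ⊗ₜ (X ^ (d + e))) - τ ((X ^ b) ⊗ₜ (X ^ (d + e)))) := by
    rw [l1, l2]; module
  have hr : σ ((X ^ b) ⊗ₜ (X ^ (d + e))) - τ ((X ^ b) ⊗ₜ (X ^ (d + e))) =
      coeffY c b d • (σ ((X ^ (b + d)) ⊗ₜ (X ^ e)) - τ ((X ^ (b + d)) ⊗ₜ (X ^ e))) := by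
    rw [r1, r2]; module
  have h0 : σ ((X ^ (b + d)) ⊗ₜ (X ^ e)) - τ ((X ^ (b + d)) ⊗ₜ (X ^ e)) = 0 := by
    rw [hr, smul_smul] at hl
    refine (smul_eq_zero.1 ?_).resolve_left (sub_ne_zero.2 key)
    rw [sub_smul, one_smul, ← hl, sub_self]
  exact ⟨sub_eq_zero.1 h0, sub_eq_zero.1 (by rw [hr, h0, smul_zero])⟩

lemma uep_of_conds {c : 𝕜} (hc : ∀ n : ℕ, 1 ≤ n → (S 𝕜 n).eval c ≠ 0)
    {τ : 𝕜[X] ⊗[𝕜] 𝕜[X] →ₗ[𝕜] 𝕜[X] ⊗[𝕜] 𝕜[X]} (h : conds18 𝕜 c τ) :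
    UEP 𝕜 𝕜[X] 𝕜[X] (polyGrade 𝕜) (polyGrade 𝕜) τ := by
  intro n hn σ hσ hlt x hx
  have hτ : TwistingToDeg 𝕜 𝕜[X] 𝕜[X] (polyGrade 𝕜) (polyGrade 𝕜) τ n :=
    IsGradedTwisting.twistingToDeg ⟨isTwisting_of_conds hc h, isGradedMap_of_conds hc h⟩ n
  have eτ := twisting_map_apply hc h
  have eσ : ∀ i j, i + j < n → σ ((X ^ i) ⊗ₜ (X ^ j)) =
      coeffX c i j • ((X ^ (i + j)) ⊗ₜ[𝕜] (1 : 𝕜[X])) +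
        coeffY c i j • ((1 : 𝕜[X]) ⊗ₜ[𝕜] (X ^ (i + j))) := fun i j hij => by
    rw [← eτ]
    exact hlt _ hij _ (tmul_mem_kunneth (X_pow_mem_polyGrade i) (X_pow_mem_polyGrade j))
  rw [kunneth_polyGrade] at hx
  refine LinearMap.eqOn_span (f := σ) (g := τ) ?_ hx
  rintro _ ⟨i, j, rfl, rfl⟩
  rcases Nat.eq_zero_or_pos i with rfl | hi
  · rw [pow_zero, hσ.one_tmul_X_pow (by omega), hτ.one_tmul_X_pow (by omega)]
  rcases Nat.eq_zero_or_pos j with rfl | hj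
  · rw [pow_zero, hσ.X_pow_tmul_one (by omega), hτ.X_pow_tmul_one (by omega)]
  rcases Nat.lt_or_ge 1 i with hi' | hi'
  · obtain ⟨d, rfl⟩ := Nat.exists_eq_add_of_lt hi'
    exact (TwistingToDeg.eq_of_lt hc hτ hσ (fun i j _ => eτ i j) eσ one_pos d.succ_pos hj rfl).1
  · obtain ⟨e, rfl⟩ : ∃ e, j = 1 + (e + 1) := ⟨j - 2, by omega⟩
    exact (TwistingToDeg.eq_of_lt hc hτ hσ (fun i j _ => eτ i j) eσ hi one_pos e.succ_pos
      (by omega)).2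

end Poly

/-- Let `A = 𝕜[x]`, `B = 𝕜[y]` and suppose `c ∈ 𝕜` is not a root of any `S_n(t)`, `n ≥ 1`.
Then the linear map `τ` defined by the unital twisting conditions together with
`τ(y^i ⊗ x^j) = S_{i+j}(c)⁻¹ (S_j(c) x^{i+j} ⊗ 1 + c^j S_i(c) 1 ⊗ y^{i+j})` (for `i, j ≥ 1`)
is a graded twisting map, and it has the unique extension property. -/
theorem stmt18 (𝕜 : Type) [Field 𝕜] (c : 𝕜)
    (hc : ∀ n : ℕ, 1 ≤ n → (S 𝕜 n).eval c ≠ 0) :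
    (∃ τ : (Polynomial 𝕜) ⊗[𝕜] (Polynomial 𝕜) →ₗ[𝕜] (Polynomial 𝕜) ⊗[𝕜] (Polynomial 𝕜),
      conds18 𝕜 c τ) ∧
    (∀ τ : (Polynomial 𝕜) ⊗[𝕜] (Polynomial 𝕜) →ₗ[𝕜] (Polynomial 𝕜) ⊗[𝕜] (Polynomial 𝕜),
      conds18 𝕜 c τ →
        IsGradedTwisting 𝕜 (Polynomial 𝕜) (Polynomial 𝕜) (polyGrade 𝕜) (polyGrade 𝕜) τ ∧
        UEP 𝕜 (Polynomial 𝕜) (Polynomial 𝕜) (polyGrade 𝕜) (polyGrade 𝕜) τ) := by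
  exact ⟨exists_twisting_map hc, fun τ h =>
    ⟨⟨isTwisting_of_conds hc h, isGradedMap_of_conds hc h⟩, uep_of_conds hc h⟩⟩

end TTP
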